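/- arXiv:0802.0563 — 2 statements merged into one kernel-verified Lean document; each statement's English description precedes it below -/
import Mathlib

section
/- Let q = (√5 − 1)/2 and let f : ℝ → ℝ be a solution of Schilling's problem for q. Then f(x) = 0 for every x in the set ℤ + qℤ = {m + nq : m, n ∈ ℤ}. -/
set_option maxHeartbeats 4000000 in
theorem schilling_aux (q c : ℝ) (h1 : 0.618 < q) (h2 : q < 0.6181) (hc : c * (4 * q) = 1)
    (F : ℤ → ℤ → ℝ)
    (E : ∀ m n : ℤ, F m n = c * (F (m + n - 1) m + F (m + n + 1) m + 2 * F (m + n) m))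
    (V : ∀ m n : ℤ, 1 + q < |(m : ℝ) + n * q| → F m n = 0) :
    ∀ m n : ℤ, F m n = 0 := by
  have P : ∀ m n : ℤ, 1 + q < (m : ℝ) + n * q → F m n = 0 := fun m n h =>
    V m n (lt_of_lt_of_le h (le_abs_self _))
  have N : ∀ m n : ℤ, (m : ℝ) + n * q < -(1 + q) → F m n = 0 := fun m n h =>
    V m n (lt_of_lt_of_le (by linarith) (neg_le_abs _))
  have c1 : 0.4044 < c := by nlinarith
  have c2 : c < 0.4046 := by nlinarith
  have z : ∀ a t : ℝ, a ≠ 1 → t = a * t → t = 0 := by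
    intro a t ha ht
    have : (a - 1) * t = 0 := by linarith
    rcases mul_eq_zero.1 this with h | h
    · exact absurd (by linarith) ha
    · exact h
  -- the points ±(1+q)
  have a1 : F 1 1 = 0 := by
    have e := E 1 1
    norm_num at e
    rw [P 3 1 (by push_cast; linarith), P 2 1 (by push_cast; linarith)] at e
    exact z c _ (by linarith) (by linarith)
  have a2 : F (-1) (-1) = 0 := by
    have e := E (-1) (-1)
    norm_num at e
    rw [N (-3) (-1) (by push_cast; linarith), N (-2) (-1) (by push_cast; linarith)] at e
    exact z c _ (by linarith) (by linarith)
  have p20 : F 2 0 = 0 := P _ _ (by push_cast; linarith)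
  have n20 : F (-2) 0 = 0 := N _ _ (by push_cast; linarith)
  have p21 : F 2 1 = 0 := P _ _ (by push_cast; linarith)
  have n21 : F (-2) (-1) = 0 := N _ _ (by push_cast; linarith)
  have e0 := E 0 0
  have e1 := E 1 0
  have e2 := E (-1) 0
  have e3 := E 0 1
  have e4 := E 0 (-1)
  norm_num [a1, a2, p20, n20, p21, n21] at e0 e1 e2 e3 e4
  have cc1 : c^2 < 0.1638 := by nlinarith
  have cc2 : 0.1635 < c^2 := by nlinarith
  have b0 : F 0 0 = 0 := by
    have k1 : (1 - 2*c^2) * F 1 0 = c^2 * F 0 0 := by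
      rw [e3] at e1; linear_combination e1
    have k2 : (1 - 2*c^2) * F (-1) 0 = c^2 * F 0 0 := by
      rw [e4] at e2; linear_combination e2
    have k3 : ((1 - 2*c^2) * (1 - 2*c) - 2 * c^3) * F 0 0 = 0 := by
      linear_combination (1 - 2*c^2) * e0 + c * k1 + c * k2
    rcases mul_eq_zero.1 k3 with h | h
    · exfalso
      nlinarith
    · exact h
  have b1 : F 1 0 = 0 := by
    rw [e3, b0] at e1
    exact z (2*c^2) _ (by linarith) (by linarith)
  have b2 : F (-1) 0 = 0 := by
    rw [e4, b0] at e2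
    exact z (2*c^2) _ (by linarith) (by linarith)
  have b3 : F 0 1 = 0 := by rw [e3, b0, b1]; ring
  have b4 : F 0 (-1) = 0 := by rw [e4, b0, b2]; ring
  have e5 := E 1 (-1)
  have e6 := E (-1) 1
  norm_num [a1, a2, b3, b4] at e5 e6
  have b5 : F 1 (-1) = 0 := by
    rw [e6] at e5
    exact z (c^2) _ (by linarith) (by linarith)
  have b6 : F (-1) 1 = 0 := by rw [e6, b5]; ring
  have Z0 : ∀ m, F m 0 = 0 := by
    intro m
    by_cases h : 2 ≤ m
    · have : (2:ℝ) ≤ m := by exact_mod_cast h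
      exact P _ _ (by push_cast; linarith)
    by_cases h' : m ≤ -2
    · have : (m:ℝ) ≤ -2 := by exact_mod_cast h'
      exact N _ _ (by push_cast; linarith)
    have : -1 ≤ m := by omega
    have : m ≤ 1 := by omega
    interval_cases m <;> assumption
  have d1 : F 0 2 = 0 := by rw [E]; simp [Z0]
  have d2 : F 0 (-2) = 0 := by rw [E]; simp [Z0]
  have d3 : F (-2) 1 = 0 := by
    rw [E]; norm_num [d2]
    rw [N (-2) (-2) (by push_cast; linarith), N (-1) (-2) (by push_cast; linarith)]; simp
  have d4 : F 2 (-1) = 0 := by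
    rw [E]; norm_num [d1]
    rw [P 2 2 (by push_cast; linarith), P 1 2 (by push_cast; linarith)]; simp
  have Z1 : ∀ m, F m 1 = 0 := by
    intro m
    by_cases h : 2 ≤ m
    · have : (2:ℝ) ≤ m := by exact_mod_cast h
      exact P _ _ (by push_cast; linarith)
    by_cases h' : m ≤ -3
    · have : (m:ℝ) ≤ -3 := by exact_mod_cast h'
      exact N _ _ (by push_cast; linarith)
    have : -2 ≤ m := by omega
    have : m ≤ 1 := by omega
    interval_cases m <;> assumption
  have Z1' : ∀ m, F m (-1) = 0 := by
    intro m
    by_cases h : 3 ≤ m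
    · have : (3:ℝ) ≤ m := by exact_mod_cast h
      exact P _ _ (by push_cast; linarith)
    by_cases h' : m ≤ -2
    · have : (m:ℝ) ≤ -2 := by exact_mod_cast h'
      exact N _ _ (by push_cast; linarith)
    have : -1 ≤ m := by omega
    have : m ≤ 2 := by omega
    interval_cases m <;> assumption
  -- if all values on row `m` vanish, so does `F m n`
  have S : ∀ m n, (∀ k, F k m = 0) → F m n = 0 := by
    intro m n h; rw [E]; simp [h]
  have g1 : F (-2) 2 = 0 := by
    rw [E]; norm_num [d2, S 1 (-2) Z1, S (-1) (-2) Z1']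
  have g2 : F 2 (-2) = 0 := by
    rw [E]; norm_num [d1, S 1 2 Z1, S (-1) 2 Z1']
  have Z2 : ∀ m, F m 2 = 0 := by
    intro m
    by_cases h : 1 ≤ m
    · have : (1:ℝ) ≤ m := by exact_mod_cast h
      exact P _ _ (by push_cast; linarith)
    by_cases h' : m ≤ -3
    · have : (m:ℝ) ≤ -3 := by exact_mod_cast h'
      exact N _ _ (by push_cast; linarith)
    have : -2 ≤ m := by omega
    have : m ≤ 0 := by omega
    interval_cases m
    · assumption
    · exact S _ _ Z1'
    · assumption
  have Z2' : ∀ m, F m (-2) = 0 := by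
    intro m
    by_cases h : 3 ≤ m
    · have : (3:ℝ) ≤ m := by exact_mod_cast h
      exact P _ _ (by push_cast; linarith)
    by_cases h' : m ≤ -1
    · have : (m:ℝ) ≤ -1 := by exact_mod_cast h'
      exact N _ _ (by push_cast; linarith)
    have : 0 ≤ m := by omega
    have : m ≤ 2 := by omega
    interval_cases m
    · assumption
    · exact S _ _ Z1
    · assumption
  -- F (-3) 3 has predecessors (-1,-3), (0,-3), (1,-3)
  have Z3 : ∀ m, F m 3 = 0 := by
    intro m
    by_cases h : 0 ≤ m
    · have : (0:ℝ) ≤ m := by exact_mod_cast h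
      exact P _ _ (by push_cast; linarith)
    by_cases h' : m ≤ -4
    · have : (m:ℝ) ≤ -4 := by exact_mod_cast h'
      exact N _ _ (by push_cast; linarith)
    have : -3 ≤ m := by omega
    have : m ≤ -1 := by omega
    interval_cases m
    · rw [E]; norm_num [S 1 (-3) Z1, S (-1) (-3) Z1', S 0 (-3) Z0]
    · exact S _ _ Z2'
    · exact S _ _ Z1'
  have Z3' : ∀ m, F m (-3) = 0 := by
    intro m
    by_cases h : 4 ≤ m
    · have : (4:ℝ) ≤ m := by exact_mod_cast h
      exact P _ _ (by push_cast; linarith)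
    by_cases h' : m ≤ 0
    · have : (m:ℝ) ≤ 0 := by exact_mod_cast h'
      exact N _ _ (by push_cast; linarith)
    have : 1 ≤ m := by omega
    have : m ≤ 3 := by omega
    interval_cases m
    · exact S _ _ Z1
    · exact S _ _ Z2
    · rw [E]; norm_num [S 1 3 Z1, S (-1) 3 Z1', S 0 3 Z0]
  have Z4 : ∀ m, F m 4 = 0 := by
    intro m
    by_cases h : 0 ≤ m
    · have : (0:ℝ) ≤ m := by exact_mod_cast h
      exact P _ _ (by push_cast; linarith)
    by_cases h' : m ≤ -5
    · have : (m:ℝ) ≤ -5 := by exact_mod_cast h'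
      exact N _ _ (by push_cast; linarith)
    have : -4 ≤ m := by omega
    have : m ≤ -1 := by omega
    interval_cases m
    · rw [E]; norm_num [S 1 (-4) Z1, S (-1) (-4) Z1', S 0 (-4) Z0]
    · exact S _ _ Z3'
    · exact S _ _ Z2'
    · exact S _ _ Z1'
  have Z4' : ∀ m, F m (-4) = 0 := by
    intro m
    by_cases h : 5 ≤ m
    · have : (5:ℝ) ≤ m := by exact_mod_cast h
      exact P _ _ (by push_cast; linarith)
    by_cases h' : m ≤ 0
    · have : (m:ℝ) ≤ 0 := by exact_mod_cast h'
      exact N _ _ (by push_cast; linarith)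
    have : 1 ≤ m := by omega
    have : m ≤ 4 := by omega
    interval_cases m
    · exact S _ _ Z1
    · exact S _ _ Z2
    · exact S _ _ Z3
    · rw [E]; norm_num [S 1 4 Z1, S (-1) 4 Z1', S 0 4 Z0]
  have key : ∀ k : ℕ, ∀ n : ℤ, n.natAbs = k → ∀ m, F m n = 0 := by
    intro k
    induction k using Nat.strong_induction_on with
    | _ k ih =>
      intro n hn m
      by_cases hs : k ≤ 4
      · have : -4 ≤ n := by omega
        have : n ≤ 4 := by omega
        clear hn
        interval_cases n
        · exact Z4' m
        · exact Z3' m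
        · exact Z2' m
        · exact Z1' m
        · exact Z0 m
        · exact Z1 m
        · exact Z2 m
        · exact Z3 m
        · exact Z4 m
      by_cases hm : m.natAbs < k
      · exact S _ _ (ih _ hm m rfl)
      rcases lt_or_ge n 0 with hn0 | hn0
      · have n5 : (n:ℝ) ≤ -5 := by exact_mod_cast (by omega : n ≤ -5)
        rcases lt_or_ge m 0 with hm0 | hm0
        · have : (m:ℝ) ≤ 0 := by exact_mod_cast hm0.le
          exact N _ _ (by nlinarith)
        · have : (-n:ℝ) ≤ m := by exact_mod_cast (by omega : -n ≤ m)
          exact P _ _ (by nlinarith)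
      · have n5 : (5:ℝ) ≤ n := by exact_mod_cast (by omega : 5 ≤ n)
        rcases lt_or_ge m 0 with hm0 | hm0
        · have : (m:ℝ) ≤ -n := by exact_mod_cast (by omega : m ≤ -n)
          exact N _ _ (by nlinarith)
        · have : (0:ℝ) ≤ m := by exact_mod_cast hm0
          exact P _ _ (by nlinarith)
  exact fun m n => key _ n rfl m

theorem schilling_golden (q : ℝ) (hq : q = (Real.sqrt 5 - 1) / 2)
    (f : ℝ → ℝ)
    (hfe : ∀ x : ℝ, f (q * x) = (1 / (4 * q)) * (f (x - 1) + f (x + 1) + 2 * f x))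
    (hfv : ∀ x : ℝ, |x| > q / (1 - q) → f x = 0) :
    ∀ m n : ℤ, f ((m : ℝ) + (n : ℝ) * q) = 0 := by
  have s1 : 2.236 < Real.sqrt 5 := Real.lt_sqrt_of_sq_lt (by norm_num)
  have s2 : Real.sqrt 5 < 2.2362 := (Real.sqrt_lt' (by norm_num)).2 (by norm_num)
  have h1 : 0.618 < q := by rw [hq]; linarith
  have h2 : q < 0.6181 := by rw [hq]; linarith
  have h3 : q * q = 1 - q := by
    have := Real.mul_self_sqrt (show (0:ℝ) ≤ 5 by norm_num)
    rw [hq]; linarith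
  have hQ : q / (1 - q) = 1 + q := by
    rw [div_eq_iff (by linarith)]; linarith
  refine schilling_aux q (1 / (4 * q)) h1 h2 (by field_simp) (fun m n => f ((m : ℝ) + n * q)) ?_ ?_
  · intro m n
    have e := hfe ((m + n : ℝ) + m * q)
    have e' : q * ((m + n : ℝ) + m * q) = m + n * q := by
      linear_combination (m:ℝ) * h3
    rw [e'] at e
    push_cast
    rw [e]
    congr 4 <;> ring_nf
  · intro m n h
    exact hfv _ (by rw [hQ]; exact h)
end

section
/- Let q be one of the numbers (√3 − 1)/2, (3 − √5)/2, √2 − 1, (√5 − 1)/2, set Q = q/(1−q), and let f : ℝ → ℝ be a solution of Schilling's problem for q. If there exists δ > 0 such that f is right-hand-side continuous at each point of the interval (−Q, −Q + δ), or f is left-hand-side continuous at each point of the interval (−Q, −Q + δ), then f is identically zero. -/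
lemma sch_conj (β β' : ℝ) (u v : ℤ) (hirr : Irrational β) (hβ : β ^ 2 = u * β + v)
    (hβ' : β' ^ 2 = u * β' + v) (y : ℝ) (hy : y ≠ 0) :
    ∃ ψ : ℝ →+ ℝ, (∀ x, ψ (β * x) = β' * ψ x) ∧ ψ y ≠ 0 := by
  let p : Polynomial ℚ :=
    Polynomial.X ^ 2 - Polynomial.C (u : ℚ) * Polynomial.X - Polynomial.C (v : ℚ)
  have hdeg : p.natDegree = 2 := by
    simp only [p]; compute_degree!
  have hmonic : p.Monic := by
    simp only [p]; monicity!
  have hirrp : Irreducible p := by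
    rw [hmonic.irreducible_iff_roots_eq_zero_of_degree_le_three (by omega) (by omega)]
    rw [Multiset.eq_zero_iff_forall_notMem]
    intro r hr
    have h1 : p.eval r = 0 := (Polynomial.mem_roots'.1 hr).2
    have h2 : r ^ 2 - u * r - v = 0 := by simpa [p] using h1
    have h3 : (r : ℝ) ^ 2 - u * r - v = 0 := by exact_mod_cast h2
    have h4 : (β - r) * (β - ((u - r : ℚ) : ℝ)) = 0 := by
      push_cast
      linear_combination hβ - h3
    rcases mul_eq_zero.1 h4 with h | h
    · exact hirr ⟨r, by linarith⟩
    · exact hirr ⟨(u - r : ℚ), by linarith⟩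
  haveI : Fact (Irreducible p) := ⟨hirrp⟩
  have e1 : p.eval₂ (algebraMap ℚ ℝ) β = 0 := by
    simp only [p, Polynomial.eval₂_sub, Polynomial.eval₂_mul, Polynomial.eval₂_pow,
      Polynomial.eval₂_X, Polynomial.eval₂_C]
    simp only [map_intCast]
    linarith
  have e2 : p.eval₂ (algebraMap ℚ ℝ) β' = 0 := by
    simp only [p, Polynomial.eval₂_sub, Polynomial.eval₂_mul, Polynomial.eval₂_pow,
      Polynomial.eval₂_X, Polynomial.eval₂_C]
    simp only [map_intCast]
    linarith
  let ι : AdjoinRoot p →+* ℝ := AdjoinRoot.lift (algebraMap ℚ ℝ) β e1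
  let σ : AdjoinRoot p →+* ℝ := AdjoinRoot.lift (algebraMap ℚ ℝ) β' e2
  letI : Module (AdjoinRoot p) ℝ := Module.compHom ℝ ι
  have hsm : ∀ x : ℝ, (AdjoinRoot.root p) • x = β * x := by
    intro x
    change ι (AdjoinRoot.root p) * x = _
    rw [AdjoinRoot.lift_root]
  have hex : ∃ φ : Module.Dual (AdjoinRoot p) ℝ, φ y ≠ 0 := by
    by_contra! h
    exact hy ((Module.forall_dual_apply_eq_zero_iff (AdjoinRoot p) y).1 h)
  obtain ⟨φ, hφ⟩ := hex
  refine ⟨(σ : AdjoinRoot p →+ ℝ).comp (φ : ℝ →+ AdjoinRoot p), ?_, ?_⟩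
  · intro x
    change σ (φ (β * x)) = β' * σ (φ x)
    rw [← hsm, map_smul, smul_eq_mul, map_mul, AdjoinRoot.lift_root]
  · change σ (φ y) ≠ 0
    exact (map_ne_zero σ).2 hφ

lemma sch_zero (β β' Q : ℝ) (u v : ℤ) (hirr : Irrational β) (hβ : β ^ 2 = u * β + v)
    (hβ' : β' ^ 2 = u * β' + v) (h1 : 1 < β) (h2 : |β'| < 1) (f : ℝ → ℝ)
    (hfe : ∀ x, 4 * f x = β * (f (β * x - 1) + f (β * x + 1) + 2 * f (β * x)))
    (hfv : ∀ x, |x| > Q → f x = 0) (m₀ n₀ : ℤ) : f (m₀ + n₀ * β) = 0 := by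
  by_contra hne
  obtain ⟨ψ, hψ, hψ0⟩ := sch_conj β β' u v hirr hβ hβ' _ hne
  obtain ⟨C, hC1, hC2⟩ : ∃ C : ℝ, |m₀ + n₀ * β'| ≤ C ∧ |β'| * C + 1 ≤ C := by
    refine ⟨max |m₀ + n₀ * β'| (1 / (1 - |β'|)), le_max_left _ _, ?_⟩
    have := le_max_right |m₀ + n₀ * β'| (1 / (1 - |β'|))
    rw [div_le_iff₀ (by linarith)] at this
    linarith
  let S : Set (ℤ × ℤ) := {p | |(p.1 : ℝ) + p.2 * β| ≤ Q ∧ |(p.1 : ℝ) + p.2 * β'| ≤ C}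
  have hbb : 0 < β - β' := by have := (abs_lt.1 h2).2; linarith
  have hfin : S.Finite := by
    obtain ⟨N, hN⟩ := exists_nat_ge ((Q + C) / (β - β'))
    obtain ⟨M, hM⟩ := exists_nat_ge (Q + N * β)
    refine ((Set.finite_Icc (-(M : ℤ)) M).prod (Set.finite_Icc (-(N : ℤ)) N)).subset ?_
    rintro ⟨m, n⟩ ⟨ha, hb⟩
    rw [div_le_iff₀ hbb] at hN
    simp only at ha hb
    rw [abs_le] at ha hb
    have hn1 : (n : ℝ) ≤ N := by
      by_contra! h
      nlinarith
    have hn2 : -(N : ℝ) ≤ n := by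
      by_contra! h
      nlinarith
    have hm1 : (m : ℝ) ≤ M := by nlinarith
    have hm2 : -(M : ℝ) ≤ m := by nlinarith
    refine ⟨⟨?_, ?_⟩, ⟨?_, ?_⟩⟩
    · exact_mod_cast hm2
    · exact_mod_cast hm1
    · exact_mod_cast hn2
    · exact_mod_cast hn1
  have hmem : (m₀, n₀) ∈ S := by
    refine ⟨?_, hC1⟩
    by_contra! h
    exact hne (hfv _ h)
  obtain ⟨⟨m, n⟩, hp, hmax⟩ := Set.exists_max_image S
    (fun p => |ψ (f (p.1 + p.2 * β))|) hfin ⟨_, hmem⟩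
  simp only at hmax
  have hpos := hmax _ hmem
  have hpos' : 0 < |ψ (f (m₀ + n₀ * β))| := abs_pos.2 hψ0
  set W := |ψ (f (m + n * β))| with hW
  have key : ∀ e : ℤ, |(e : ℝ)| ≤ 1 → |ψ (f (β * (m + n * β) + e))| ≤ W := by
    intro e he
    by_cases hQ : |β * (m + n * β) + e| ≤ Q
    · have hx : β * (m + n * β) + e = ((n * v + e : ℤ) : ℝ) + ((m + n * u : ℤ) : ℝ) * β := by
        push_cast; linear_combination n * hβ
      have hx' : β' * (m + n * β') + e = ((n * v + e : ℤ) : ℝ) + ((m + n * u : ℤ) : ℝ) * β' := by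
        push_cast; linear_combination n * hβ'
      have := hmax (n * v + e, m + n * u) ⟨by rw [← hx]; exact hQ, by
        rw [← hx']
        calc _ ≤ |β' * (m + n * β')| + |(e : ℝ)| := abs_add_le _ _
          _ ≤ |β'| * C + 1 := by
            rw [abs_mul]
            gcongr
            exact hp.2
          _ ≤ C := hC2⟩
      rw [hx]
      exact this
    · rw [hfv _ (not_le.1 hQ)]
      simp [W]
  have k1 := key (-1) (by simp)
  have k2 := key 1 (by simp)
  have k3 := key 0 (by simp)
  have heq := congrArg ψ (hfe (m + n * β))
  have four : ∀ z, ψ (4 * z) = 4 * ψ z := fun z => by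
    rw [show 4 * z = z + z + z + z by ring]; simp only [map_add]; ring
  have two : ∀ z, ψ (2 * z) = 2 * ψ z := fun z => by
    rw [show 2 * z = z + z by ring]; simp only [map_add]; ring
  rw [four, hψ, map_add, map_add, two] at heq
  push_cast at k1 k2 k3
  rw [← sub_eq_add_neg] at k1
  rw [add_zero] at k3
  have habs := congrArg abs heq
  rw [abs_mul, abs_mul] at habs
  have hs : |ψ (f (β * (m + n * β) - 1)) + ψ (f (β * (m + n * β) + 1))
      + 2 * ψ (f (β * (m + n * β)))| ≤ 4 * W := by
    rw [abs_le] at *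
    constructor <;> linarith [k1.1, k1.2, k2.1, k2.2, k3.1, k3.2]
  rw [← hW, abs_of_pos (by norm_num : (0 : ℝ) < 4)] at habs
  have hb0 := abs_nonneg β'
  nlinarith [mul_le_mul_of_nonneg_left hs hb0]

lemma sch_prop (q : ℝ) (h0 : 0 < q) (h1 : q < 1) (h4 : 4 * q ≠ 1) (f : ℝ → ℝ)
    (hfe : ∀ x : ℝ, f (q * x) = (1 / (4 * q)) * (f (x - 1) + f (x + 1) + 2 * f x))
    (hfv : ∀ x : ℝ, |x| > q / (1 - q) → f x = 0) (δ : ℝ) (hδ : 0 < δ)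
    (hz : ∀ x ∈ Set.Ioo (-(q / (1 - q))) (-(q / (1 - q)) + δ), f x = 0) :
    ∀ x, f x = 0 := by
  set Q := q / (1 - q) with hQ
  have hQq : Q = q + q * Q := by rw [hQ]; field_simp [(by linarith : 1 - q ≠ 0)]; ring
  have hQpos : 0 < Q := div_pos h0 (by linarith)
  have hlow : ∀ x, x < -Q → f x = 0 := fun x hx => hfv x (by rw [gt_iff_lt, lt_abs]; right; linarith)
  have hend : f (-Q) = 0 := by
    have h := hfe (-Q - 1)
    rw [show q * (-Q - 1) = -Q by linarith, hlow (-Q - 1 - 1) (by linarith),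
      hlow (-Q - 1) (by linarith), show -Q - 1 + 1 = -Q by ring] at h
    field_simp at h
    have : (4 * q - 1) * f (-Q) = 0 := by linarith
    exact (mul_eq_zero.1 this).resolve_left (sub_ne_zero.2 h4)
  have hbase : ∀ x, x < -Q + δ → f x = 0 := by
    intro x hx
    rcases lt_trichotomy x (-Q) with h | h | h
    · exact hlow x h
    · rw [h, hend]
    · exact hz x ⟨h, hx⟩
  obtain ⟨η, hη, hη1, hη2⟩ : ∃ η : ℝ, 0 < η ∧ η ≤ 1 ∧ q * η ≤ δ * (1 - q) := by
    refine ⟨min 1 (δ * (1 - q)), lt_min one_pos (mul_pos hδ (by linarith)), min_le_left _ _, ?_⟩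
    have a := min_le_right 1 (δ * (1 - q))
    have b : 0 < min 1 (δ * (1 - q)) := lt_min one_pos (mul_pos hδ (by linarith))
    nlinarith
  have hind : ∀ n : ℕ, ∀ x, x < -Q + δ + n * η → f x = 0 := by
    intro n
    induction n with
    | zero => intro x hx; exact hbase x (by simpa using hx)
    | succ k ih =>
      intro x hx
      push_cast at hx
      have hk : (0 : ℝ) ≤ k * η := by positivity
      have h := hfe (x - 1)
      have hqx : q * (x - 1) < -Q + δ + k * η := by nlinarith
      rw [ih _ hqx, ih (x - 1 - 1) (by linarith), ih (x - 1) (by linarith),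
        show x - 1 + 1 = x by ring] at h
      field_simp at h
      linarith
  intro x
  obtain ⟨n, hn⟩ := exists_nat_gt ((x + Q - δ) / η)
  rw [div_lt_iff₀ hη] at hn
  exact hind n x (by linarith)

lemma sch_main (q β' : ℝ) (u v : ℤ) (h0 : 0 < q) (h1 : q < 1) (h4 : 4 * q ≠ 1)
    (hirr : Irrational q) (hβ : 1 = u * q + v * q ^ 2)
    (hβ' : β' ^ 2 = u * β' + v) (h2 : |β'| < 1) (f : ℝ → ℝ)
    (hfe : ∀ x : ℝ, f (q * x) = (1 / (4 * q)) * (f (x - 1) + f (x + 1) + 2 * f x))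
    (hfv : ∀ x : ℝ, |x| > q / (1 - q) → f x = 0)
    (hδ : ∃ δ > (0 : ℝ),
        (∀ x ∈ Set.Ioo (-(q / (1 - q))) (-(q / (1 - q)) + δ),
            Filter.Tendsto f (nhdsWithin x (Set.Ioi x)) (nhds (f x))) ∨
        (∀ x ∈ Set.Ioo (-(q / (1 - q))) (-(q / (1 - q)) + δ),
            Filter.Tendsto f (nhdsWithin x (Set.Iio x)) (nhds (f x)))) :
    ∀ x : ℝ, f x = 0 := by
  have hirr' : Irrational (q⁻¹) := irrational_inv_iff.2 hirr
  have hL : ∀ m n : ℤ, f (m + n * q⁻¹) = 0 := by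
    refine sch_zero q⁻¹ β' (q / (1 - q)) u v hirr' ?_ hβ' ((one_lt_inv₀ h0).2 h1) h2 f ?_ hfv
    · field_simp; linarith
    · intro x
      have h := hfe (q⁻¹ * x)
      rw [mul_inv_cancel_left₀ h0.ne'] at h
      rw [h]; field_simp
  have hdense : Dense {x | f x = 0} := by
    have hd : Dense (AddSubgroup.closure {q⁻¹, 1} : Set ℝ) :=
      dense_addSubgroupClosure_pair_iff.2 (by simpa using hirr')
    refine hd.mono ?_
    intro x hx
    obtain ⟨a, b, hab⟩ := AddSubgroup.mem_closure_pair.1 hx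
    have := hL b a
    simp only [zsmul_eq_mul, mul_one] at hab
    rw [add_comm, hab] at this
    exact this
  obtain ⟨δ, hδ0, hc⟩ := hδ
  refine sch_prop q h0 h1 h4 f hfe hfv δ hδ0 ?_
  intro x hx
  rcases hc with hc | hc
  · by_contra hne
    have h := (hc x hx).eventually_ne hne
    obtain ⟨b, hb, hsub⟩ := mem_nhdsGT_iff_exists_Ioo_subset.1 h
    obtain ⟨z, hz, hz2⟩ := hdense.exists_between hb
    exact hsub hz2 hz
  · by_contra hne
    have h := (hc x hx).eventually_ne hne
    obtain ⟨b, hb, hsub⟩ := mem_nhdsLT_iff_exists_Ioo_subset.1 h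
    obtain ⟨z, hz, hz2⟩ := hdense.exists_between hb
    exact hsub hz2 hz

theorem schilling_onesided_cont_left_interval (q : ℝ)
    (hq : q = (Real.sqrt 3 - 1) / 2 ∨ q = (3 - Real.sqrt 5) / 2 ∨
        q = Real.sqrt 2 - 1 ∨ q = (Real.sqrt 5 - 1) / 2)
    (f : ℝ → ℝ)
    (hfe : ∀ x : ℝ, f (q * x) = (1 / (4 * q)) * (f (x - 1) + f (x + 1) + 2 * f x))
    (hfv : ∀ x : ℝ, |x| > q / (1 - q) → f x = 0)
    (hδ : ∃ δ > (0 : ℝ),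
        (∀ x ∈ Set.Ioo (-(q / (1 - q))) (-(q / (1 - q)) + δ),
            Filter.Tendsto f (nhdsWithin x (Set.Ioi x)) (nhds (f x))) ∨
        (∀ x ∈ Set.Ioo (-(q / (1 - q))) (-(q / (1 - q)) + δ),
            Filter.Tendsto f (nhdsWithin x (Set.Iio x)) (nhds (f x)))) :
    ∀ x : ℝ, f x = 0 := by
  have i2 : Irrational (Real.sqrt 2) := irrational_sqrt_two
  have i3 : Irrational (Real.sqrt 3) := by
    simpa using Nat.Prime.irrational_sqrt (p := 3) (by norm_num)
  have i5 : Irrational (Real.sqrt 5) := by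
    simpa using Nat.Prime.irrational_sqrt (p := 5) (by norm_num)
  have s2 : Real.sqrt 2 ^ 2 = 2 := Real.sq_sqrt (by norm_num)
  have s3 : Real.sqrt 3 ^ 2 = 3 := Real.sq_sqrt (by norm_num)
  have s5 : Real.sqrt 5 ^ 2 = 5 := Real.sq_sqrt (by norm_num)
  have l2 : 1.4 < Real.sqrt 2 := Real.lt_sqrt_of_sq_lt (by norm_num)
  have l3 : 1.7 < Real.sqrt 3 := Real.lt_sqrt_of_sq_lt (by norm_num)
  have l5 : 2.2 < Real.sqrt 5 := Real.lt_sqrt_of_sq_lt (by norm_num)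
  have r2 : Real.sqrt 2 < 1.5 := by rw [Real.sqrt_lt' (by norm_num)]; norm_num
  have r3 : Real.sqrt 3 < 1.8 := by rw [Real.sqrt_lt' (by norm_num)]; norm_num
  have r5 : Real.sqrt 5 < 2.3 := by rw [Real.sqrt_lt' (by norm_num)]; norm_num
  rcases hq with hq | hq | hq | hq
  · refine sch_main q (1 - Real.sqrt 3) 2 2 ?_ ?_ ?_ ?_ ?_ ?_ ?_ f hfe hfv hδ
    · linarith
    · linarith
    · intro h; linarith
    · rintro ⟨r, hr⟩; exact i3 ⟨2 * r + 1, by push_cast; linarith⟩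
    · rw [hq]; push_cast; linarith
    · push_cast; linarith
    · rw [abs_lt]; constructor <;> linarith
  · refine sch_main q ((3 - Real.sqrt 5) / 2) 3 (-1) ?_ ?_ ?_ ?_ ?_ ?_ ?_ f hfe hfv hδ
    · linarith
    · linarith
    · intro h; linarith
    · rintro ⟨r, hr⟩; exact i5 ⟨3 - 2 * r, by push_cast; linarith⟩
    · rw [hq]; push_cast; linarith
    · push_cast; linarith
    · rw [abs_lt]; constructor <;> linarith
  · refine sch_main q (1 - Real.sqrt 2) 2 1 ?_ ?_ ?_ ?_ ?_ ?_ ?_ f hfe hfv hδ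
    · linarith
    · linarith
    · intro h; linarith
    · rintro ⟨r, hr⟩; exact i2 ⟨r + 1, by push_cast; linarith⟩
    · rw [hq]; push_cast; linarith
    · push_cast; linarith
    · rw [abs_lt]; constructor <;> linarith
  · refine sch_main q ((1 - Real.sqrt 5) / 2) 1 1 ?_ ?_ ?_ ?_ ?_ ?_ ?_ f hfe hfv hδ
    · linarith
    · linarith
    · intro h; linarith
    · rintro ⟨r, hr⟩; exact i5 ⟨2 * r + 1, by push_cast; linarith⟩
    · rw [hq]; push_cast; linarith
    · push_cast; linarith
    · rw [abs_lt]; constructor <;> linarith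
end
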